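/- Let Ω ⊆ ℝ³ be open, let c : Ω → ℂ, and let 0 < k̲ < k̄. Let v : Ω × [k̲, k̄] → ℂ be such that v(·, k) is twice continuously differentiable in x, v(x, ·) is continuously differentiable in k, the mixed derivatives commute (∂_k(∂v/∂x_i) = ∂/∂x_i(∂_k v) and ∂_k(Δ_x v) = Δ_x(∂_k v)), and q(x, k) = ∂_k v(x, k) together with ∇_x q and Δ_x q are continuous in (x, k). Suppose Δ_x v(x, k) + (∇_x v(x, k))² = −k² c(x) for all (x, k) ∈ Ω × [k̲, k̄]. Define the tail function V(x) = v(x, k̄). Then for all x ∈ Ω and all k ∈ [k̲, k̄] the following integro-differential equation holds: (k/2) Δ_x q(x, k) + k ∇_x q(x, k) · ( −∫_k^{k̄} ∇_x q(x, s) ds + ∇V(x) ) = −∫_k^{k̄} Δ_x q(x, s) ds + ΔV(x) + ( −∫_k^{k̄} ∇_x q(x, s) ds + ∇V(x) )². -/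

import Mathlib

noncomputable section

/-- The spatial Laplacian `Δ_x f = Σᵢ ∂²f/∂xᵢ²` of `f : ℝ³ → ℂ`. -/
def lap3 (f : (Fin 3 → ℝ) → ℂ) (x : Fin 3 → ℝ) : ℂ :=
  ∑ i : Fin 3, fderiv ℝ (fun y => fderiv ℝ f y (Pi.single i 1)) x (Pi.single i 1)

/-- The `i`-th spatial partial derivative of `f : ℝ³ → ℂ`. -/
def pd (i : Fin 3) (f : (Fin 3 → ℝ) → ℂ) (x : Fin 3 → ℝ) : ℂ :=
  fderiv ℝ f x (Pi.single i 1)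

open Filter Topology Set

/-- Second derivative test at a local max. -/
theorem aux_second (g g' : ℝ → ℝ) (g2 : ℝ) (h1 : ∀ᶠ t in 𝓝 (0:ℝ), HasDerivAt g (g' t) t)
    (h2 : HasDerivAt g' g2 0) (hm : IsLocalMax g 0) : g2 ≤ 0 := by
  by_contra hcon
  push Not at hcon
  have e1 : deriv g =ᶠ[𝓝 0] g' := h1.mono fun t ht => ht.deriv
  have e2 : deriv (deriv g) 0 = g2 := by rw [e1.deriv_eq]; exact h2.deriv
  have hmin : IsLocalMin g 0 :=
    isLocalMin_of_deriv_deriv_pos (by rw [e2]; exact hcon) hm.deriv_eq_zero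
      h1.self_of_nhds.continuousAt
  have hc : g =ᶠ[𝓝 0] fun _ => g 0 := by
    filter_upwards [hm, hmin] with t a b using le_antisymm a b
  have : deriv g =ᶠ[𝓝 0] fun _ => 0 := by
    have := hc.deriv
    simpa using this
  have := this.deriv_eq
  rw [e2] at this
  simp at this
  linarith

theorem aux_diff1 {F : Type*} [NormedAddCommGroup F] [NormedSpace ℝ F]
    {Ω : Set (Fin 3 → ℝ)} (hΩ : IsOpen Ω) {f : (Fin 3 → ℝ) → F}
    (hf : ContDiffOn ℝ 2 f Ω) {p : Fin 3 → ℝ} (hp : p ∈ Ω) : DifferentiableAt ℝ f p :=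
  (hf.contDiffAt (hΩ.mem_nhds hp)).differentiableAt (by norm_num)

theorem aux_diff2 {F : Type*} [NormedAddCommGroup F] [NormedSpace ℝ F]
    {Ω : Set (Fin 3 → ℝ)} (hΩ : IsOpen Ω) {f : (Fin 3 → ℝ) → F}
    (hf : ContDiffOn ℝ 2 f Ω) {p : Fin 3 → ℝ} (hp : p ∈ Ω) (e : Fin 3 → ℝ) :
    DifferentiableAt ℝ (fun y => fderiv ℝ f y e) p := by
  have h := (hf.contDiffAt (hΩ.mem_nhds hp)).fderiv_right (m := 1) (by norm_num)
  exact (h.differentiableAt (by norm_num)).clm_apply (differentiableAt_const _)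

theorem aux_line {Ω : Set (Fin 3 → ℝ)} (hΩ : IsOpen Ω) {f : (Fin 3 → ℝ) → ℝ}
    (hf : ContDiffOn ℝ 2 f Ω) {p : Fin 3 → ℝ} (hp : p ∈ Ω) (e : Fin 3 → ℝ) (s : ℝ) :
    (∀ᶠ t in 𝓝 (0:ℝ), HasDerivAt (fun t : ℝ => f (p + (t * s) • e))
      (s * fderiv ℝ f (p + (t * s) • e) e) t) ∧
    HasDerivAt (fun t : ℝ => s * fderiv ℝ f (p + (t * s) • e) e)
      (s ^ 2 * fderiv ℝ (fun y => fderiv ℝ f y e) p e) 0 := by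
  have hl : ∀ t : ℝ, HasDerivAt (fun t : ℝ => p + (t * s) • e) (s • e) t := by
    intro t
    have := (((hasDerivAt_id t).mul_const s).smul_const e).const_add p
    simpa using this
  constructor
  · have hc : ContinuousAt (fun t : ℝ => p + (t * s) • e) 0 := (hl 0).continuousAt
    have : ∀ᶠ t in 𝓝 (0:ℝ), p + (t * s) • e ∈ Ω :=
      hc.eventually_mem (hΩ.mem_nhds (by simpa using hp))
    filter_upwards [this] with t ht
    have := (aux_diff1 hΩ hf ht).hasFDerivAt.comp_hasDerivAt t (hl t)
    simpa [Function.comp_def] using this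
  · have h2 := aux_diff2 hΩ hf hp e
    have h3 : HasFDerivAt (fun y => fderiv ℝ f y e) (fderiv ℝ (fun y => fderiv ℝ f y e) p)
        (p + ((0:ℝ) * s) • e) := by simpa using h2.hasFDerivAt
    have := (h3.comp_hasDerivAt 0 (hl 0)).const_mul s
    simp only [map_smul, smul_eq_mul] at this
    exact this.congr_deriv (by ring)

/-- Comparison function. -/
def psi (x : Fin 3 → ℝ) (i : Fin 3) (d M N : ℝ) (y : Fin 3 → ℝ) : ℝ :=
  2 * (M / d ^ 2 * (∑ j, (y j - x j) ^ 2 - 3 * (y i - x i) ^ 2 + 3 * d * (y i - x i))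
    + N / 2 * (d * (y i - x i) - (y i - x i) ^ 2))

theorem aux_psi (x : Fin 3 → ℝ) (i j : Fin 3) (d M N : ℝ) (p : Fin 3 → ℝ) :
    ∃ A : ℝ, ∀ t : ℝ, psi x i d M N (p + t • Pi.single j 1) = psi x i d M N p + A * t
      + (M / d ^ 2 * (2 - if j = i then 6 else 0) - (if j = i then N else 0)) * t ^ 2 := by
  refine ⟨2 * (M / d ^ 2 * (2 * (p j - x j) + if j = i then - 6 * (p i - x i) + 3 * d else 0)
    + if j = i then N / 2 * (d - 2 * (p i - x i)) else 0), fun t => ?_⟩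
  unfold psi
  fin_cases i <;> fin_cases j <;> simp [Fin.sum_univ_three, Pi.single_apply] <;> ring

theorem aux_psi_bd (x : Fin 3 → ℝ) (i j : Fin 3) (d M N : ℝ) (hd : 0 < d) (hM : 0 ≤ M)
    (hN : 0 ≤ N) (p : Fin 3 → ℝ) (h0 : 0 ≤ p i - x i) (h1 : p i - x i ≤ d)
    (hj : d ^ 2 ≤ (p j - x j) ^ 2) :
    2 * M ≤ psi x i d M N p := by
  have key : d ^ 2 ≤ ∑ j, (p j - x j) ^ 2 - 3 * (p i - x i) ^ 2 + 3 * d * (p i - x i) := by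
    fin_cases i <;> fin_cases j <;> simp only [Fin.sum_univ_three, Fin.zero_eta, Fin.mk_one, Fin.reduceFinMk] at * <;> nlinarith [sq_nonneg (p 0 - x 0), sq_nonneg (p 1 - x 1), sq_nonneg (p 2 - x 2), mul_nonneg h0 (sub_nonneg.2 h1), mul_nonneg h0 hd.le]
  have h2 : 0 ≤ N / 2 * (d * (p i - x i) - (p i - x i) ^ 2) := by
    apply mul_nonneg (by linarith); nlinarith
  have h3 : M ≤ M / d ^ 2 * (∑ j, (p j - x j) ^ 2 - 3 * (p i - x i) ^ 2 + 3 * d * (p i - x i)) := by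
    calc M = M / d ^ 2 * d ^ 2 := by field_simp
      _ ≤ _ := by gcongr
  unfold psi
  linarith

theorem aux_psi_zero (x : Fin 3 → ℝ) (i : Fin 3) (d M N : ℝ) (hM : 0 ≤ M)
    (p : Fin 3 → ℝ) (h0 : p i - x i = 0) : 0 ≤ psi x i d M N p := by
  unfold psi
  rw [h0]
  have : 0 ≤ M / d ^ 2 * ∑ j, (p j - x j) ^ 2 := by positivity
  linarith

theorem aux_compare {Ω : Set (Fin 3 → ℝ)} (hΩ : IsOpen Ω) {f : (Fin 3 → ℝ) → ℝ}
    (hf : ContDiffOn ℝ 2 f Ω) (x : Fin 3 → ℝ) (d M N : ℝ) (hd : 0 < d)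
    (hB : Metric.closedBall x d ⊆ Ω) (hM : ∀ y ∈ Metric.closedBall x d, |f y| ≤ M)
    (hN : ∀ y ∈ Metric.closedBall x d, |∑ i : Fin 3,
      fderiv ℝ (fun y => fderiv ℝ f y (Pi.single i 1)) y (Pi.single i 1)| < N)
    (i : Fin 3) (y : Fin 3 → ℝ) (hy : y ∈ Metric.closedBall x d) (hyi : x i ≤ y i) :
    f y - f (y - (2 * (y i - x i)) • Pi.single i 1) ≤ psi x i d M N y := by
  have hxB : x ∈ Metric.closedBall x d := Metric.mem_closedBall_self hd.le
  have hM0 : 0 ≤ M := (abs_nonneg _).trans (hM x hxB)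
  have hN0 : 0 ≤ N := (abs_nonneg _).trans (hN x hxB).le
  have hmem : ∀ z, z ∈ Metric.closedBall x d ↔ ∀ j, |z j - x j| ≤ d := by
    intro z
    rw [Metric.mem_closedBall, dist_pi_le_iff hd.le]
    simp [Real.dist_eq]
  set R : (Fin 3 → ℝ) → (Fin 3 → ℝ) := fun y => y - (2 * (y i - x i)) • Pi.single i 1 with hR
  have hRc : Continuous R := by fun_prop
  have hRB : ∀ z ∈ Metric.closedBall x d, R z ∈ Metric.closedBall x d := by
    intro z hz
    rw [hmem] at hz ⊢
    intro j
    have := hz j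
    by_cases hj : j = i
    · subst hj
      have e : R z j - x j = -(z j - x j) := by simp [hR]; ring
      rw [e, abs_neg]; exact this
    · have e : R z j = z j := by simp [hR, hj]
      rw [e]; exact this
  set w : (Fin 3 → ℝ) → ℝ := fun y => f y - f (R y) - psi x i d M N y with hw
  set K : Set (Fin 3 → ℝ) := Metric.closedBall x d ∩ {z | x i ≤ z i} with hK
  have hKc : IsCompact K := (isCompact_closedBall x d).inter_right
    (isClosed_le continuous_const (continuous_apply i))
  have hfc : ContinuousOn f (Metric.closedBall x d) := hf.continuousOn.mono hB
  have hwc : ContinuousOn w K := by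
    have h1 : ContinuousOn f K := hfc.mono inter_subset_left
    have h2 : ContinuousOn (fun y => f (R y)) K :=
      hfc.comp hRc.continuousOn (fun z hz => hRB z hz.1)
    have h3 : Continuous (psi x i d M N) := by unfold psi; fun_prop
    exact (h1.sub h2).sub h3.continuousOn
  obtain ⟨p, hpK, hpmax⟩ := hKc.exists_isMaxOn ⟨y, hy, hyi⟩ hwc
  have hle : w y ≤ w p := hpmax ⟨hy, hyi⟩
  suffices w p ≤ 0 by
    have h : w y ≤ 0 := hle.trans this
    simp only [hw] at h
    linarith
  have hpj := (hmem p).1 hpK.1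
  have hpi : x i ≤ p i := hpK.2
  by_cases c1 : p i - x i = 0
  · have : R p = p := by simp [hR, c1]
    have h0 := aux_psi_zero x i d M N hM0 p c1
    simp only [hw, this]
    linarith
  by_cases c2 : ∃ j, |p j - x j| = d
  · obtain ⟨j, hj⟩ := c2
    have h0 := aux_psi_bd x i j d M N hd hM0 hN0 p (by linarith)
      ((le_abs_self _).trans (hpj i)) (by rw [← hj, sq_abs])
    have h1 := abs_le.1 (hM p hpK.1)
    have h2 := abs_le.1 (hM (R p) (hRB p hpK.1))
    simp only [hw]
    linarith [h1.2, h2.1]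
  exfalso
  push Not at c2
  have hlt : ∀ j, |p j - x j| < d := fun j => lt_of_le_of_ne (hpj j) (c2 j)
  have hpi' : x i < p i := lt_of_le_of_ne hpi (fun h => c1 (by rw [h]; ring))
  have hKn : K ∈ 𝓝 p := by
    refine inter_mem ?_ ?_
    · have : p ∈ Metric.ball x d := by
        rw [Metric.mem_ball, dist_pi_lt_iff hd]; simpa [Real.dist_eq] using hlt
      exact mem_of_superset (Metric.isOpen_ball.mem_nhds this) Metric.ball_subset_closedBall
    · exact mem_of_superset ((isOpen_lt continuous_const (continuous_apply i)).mem_nhds hpi')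
        (fun z (hz : x i < z i) => (le_of_lt hz : x i ≤ z i))
  have hmax : IsLocalMax w p := hpmax.isLocalMax hKn
  have main : ∀ j : Fin 3,
      fderiv ℝ (fun y => fderiv ℝ f y (Pi.single j 1)) p (Pi.single j 1)
      - fderiv ℝ (fun y => fderiv ℝ f y (Pi.single j 1)) (R p) (Pi.single j 1)
      - 2 * (M / d ^ 2 * (2 - if j = i then 6 else 0) - (if j = i then N else 0)) ≤ 0 := by
    intro j
    obtain ⟨A, hA⟩ := aux_psi x i j d M N p
    set B := (M / d ^ 2 * (2 - if j = i then 6 else 0) - (if j = i then N else 0)) with hBdef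
    set s : ℝ := if j = i then -1 else 1 with hs
    have hs2 : s ^ 2 = 1 := by rw [hs]; split_ifs <;> norm_num
    obtain ⟨a1, a2⟩ := aux_line hΩ hf (hB hpK.1) (Pi.single j 1) 1
    obtain ⟨b1, b2⟩ := aux_line hΩ hf (hB (hRB p hpK.1)) (Pi.single j 1) s
    have hRt : ∀ t : ℝ, R (p + t • Pi.single j 1) = R p + (t * s) • Pi.single j 1 := by
      intro t
      by_cases hj : j = i
      · subst hj
        ext l
        by_cases hl : l = j
        · subst hl; simp [hR, hs]; ring
        · simp [hR, hl]
      · have : i ≠ j := fun h => hj h.symm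
        ext l
        simp [hR, hs, hj, this]; ring
    have p1 : ∀ t : ℝ, HasDerivAt (fun t : ℝ => psi x i d M N p + A * t + B * t ^ 2)
        (A + B * (2 * t)) t := by
      intro t
      have := (((hasDerivAt_id t).const_mul A).const_add (psi x i d M N p)).add
        (((hasDerivAt_id t).pow 2).const_mul B)
      exact this.congr_deriv (by simp)
    have p2 : HasDerivAt (fun t : ℝ => A + B * (2 * t)) (2 * B) 0 := by
      have := (((hasDerivAt_id (0:ℝ)).const_mul 2).const_mul B).const_add A
      exact this.congr_deriv (by ring)
    have hg : (fun t : ℝ => w (p + t • Pi.single j 1)) = fun t : ℝ =>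
        f (p + (t * 1) • Pi.single j 1) - f (R p + (t * s) • Pi.single j 1)
          - (psi x i d M N p + A * t + B * t ^ 2) := by
      funext t
      simp only [hw, hRt, hA, mul_one]
    have hloc : IsLocalMax (fun t : ℝ => w (p + t • Pi.single j 1)) 0 := by
      have hc : ContinuousAt (fun t : ℝ => p + t • (Pi.single j 1 : Fin 3 → ℝ)) 0 := by fun_prop
      have hc' : Tendsto (fun t : ℝ => p + t • (Pi.single j 1 : Fin 3 → ℝ)) (𝓝 0) (𝓝 p) := by
        simpa [ContinuousAt] using hc
      have := hc'.eventually hmax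
      filter_upwards [this] with t ht
      simpa using ht
    rw [hg] at hloc
    have := aux_second _ _ _ (by
      filter_upwards [a1, b1] with t ha hb using (ha.sub hb).sub (p1 t))
      ((a2.sub b2).sub p2) hloc
    rw [hs2] at this
    linarith
  have s1 := Finset.sum_nonpos (fun j (_ : j ∈ Finset.univ) => main j)
  rw [Finset.sum_sub_distrib, Finset.sum_sub_distrib] at s1
  have s2 : ∑ j : Fin 3, 2 * (M / d ^ 2 * (2 - if j = i then 6 else 0) - (if j = i then N else 0))
      = - (2 * N) := by
    fin_cases i <;> simp [Fin.sum_univ_three] <;> ring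
  rw [s2] at s1
  have n1 := abs_lt.1 (hN p hpK.1)
  have n2 := abs_lt.1 (hN (R p) (hRB p hpK.1))
  linarith [n1.1, n2.2]

theorem aux_grad_le {Ω : Set (Fin 3 → ℝ)} (hΩ : IsOpen Ω) {f : (Fin 3 → ℝ) → ℝ}
    (hf : ContDiffOn ℝ 2 f Ω) (x : Fin 3 → ℝ) (d M N : ℝ) (hd : 0 < d)
    (hB : Metric.closedBall x d ⊆ Ω) (hM : ∀ y ∈ Metric.closedBall x d, |f y| ≤ M)
    (hN : ∀ y ∈ Metric.closedBall x d, |∑ i : Fin 3,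
      fderiv ℝ (fun y => fderiv ℝ f y (Pi.single i 1)) y (Pi.single i 1)| < N)
    (i : Fin 3) : fderiv ℝ f x (Pi.single i 1) ≤ 3 * M / d + d * N / 2 := by
  have hx : x ∈ Ω := hB (Metric.mem_closedBall_self hd.le)
  have a := (aux_line hΩ hf hx (Pi.single i 1) 1).1.self_of_nhds
  have b := (aux_line hΩ hf hx (Pi.single i 1) (-1)).1.self_of_nhds
  obtain ⟨A, hA⟩ : ∃ C : ℝ, ∀ t : ℝ, psi x i d M N (x + t • Pi.single i 1)
      = 2 * (3 * M / d + d * N / 2) * t + C * t ^ 2 := by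
    refine ⟨-4 * (M / d ^ 2) - N, fun t => ?_⟩
    unfold psi
    have : M / d = M / d ^ 2 * d := by field_simp
    rw [mul_div_assoc, this]
    fin_cases i <;> simp [Fin.sum_univ_three] <;> ring
  have c : HasDerivAt (fun t : ℝ => 2 * (3 * M / d + d * N / 2) * t + A * t ^ 2)
      (2 * (3 * M / d + d * N / 2)) 0 := by
    have := ((hasDerivAt_id (0:ℝ)).const_mul (2 * (3 * M / d + d * N / 2))).add
        (((hasDerivAt_id (0:ℝ)).pow 2).const_mul A)
    exact this.congr_deriv (by simp)
  have h := c.sub (a.sub b)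
  rw [hasDerivAt_iff_tendsto_slope] at h
  have h' := h.mono_left (nhdsGT_le_nhdsNE (0:ℝ))
  have : 0 ≤ 2 * (3 * M / d + d * N / 2) - (1 * fderiv ℝ f (x + ((0:ℝ) * 1) • Pi.single i 1) (Pi.single i 1)
      - -1 * fderiv ℝ f (x + ((0:ℝ) * -1) • Pi.single i 1) (Pi.single i 1)) := by
    refine ge_of_tendsto h' ?_
    filter_upwards [Ioo_mem_nhdsGT hd] with t ht
    have hcmp := aux_compare hΩ hf x d M N hd hB hM hN i (x + t • Pi.single i 1) (by
      rw [Metric.mem_closedBall, dist_eq_norm]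
      rw [add_sub_cancel_left, norm_smul, Real.norm_eq_abs, abs_of_pos ht.1]
      have : ‖(Pi.single i 1 : Fin 3 → ℝ)‖ = 1 := by simp [Pi.norm_single]
      rw [this, mul_one]; exact ht.2.le) (by simp [ht.1.le])
    rw [hA] at hcmp
    have e : x + t • Pi.single i 1 - (2 * ((x + t • (Pi.single i 1 : Fin 3 → ℝ)) i - x i)) • Pi.single i 1
      = x + (t * -1) • (Pi.single i 1 : Fin 3 → ℝ) := by
      ext l; simp; ring
    rw [e] at hcmp
    rw [slope_def_field]
    apply div_nonneg _ (by linarith [ht.1])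
    simp only [Pi.sub_apply]
    rw [mul_neg_one, neg_smul] at hcmp
    simp
    linarith
  simp at this
  linarith

theorem aux_clm {Ω : Set (Fin 3 → ℝ)} (hΩ : IsOpen Ω) {F : (Fin 3 → ℝ) → ℂ}
    (hF : ContDiffOn ℝ 2 F Ω) (x : Fin 3 → ℝ) (d M N : ℝ) (hd : 0 < d)
    (hB : Metric.closedBall x d ⊆ Ω) (hM : ∀ y ∈ Metric.closedBall x d, ‖F y‖ ≤ M)
    (hN : ∀ y ∈ Metric.closedBall x d, ‖lap3 F y‖ < N) (i : Fin 3)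
    (L : ℂ →L[ℝ] ℝ) (hL : ∀ z, |L z| ≤ ‖z‖) :
    L (pd i F x) ≤ 3 * M / d + d * N / 2 := by
  have e1 : ∀ y ∈ Ω, ∀ e, fderiv ℝ (fun z => L (F z)) y e = L (fderiv ℝ F y e) := by
    intro y hy e
    have := L.hasFDerivAt.comp y (aux_diff1 hΩ hF hy).hasFDerivAt
    have h2 : fderiv ℝ (fun z => L (F z)) y = L.comp (fderiv ℝ F y) := this.fderiv
    rw [h2]; rfl
  have e2 : ∀ y ∈ Ω, ∀ e, fderiv ℝ (fun z => fderiv ℝ (fun z => L (F z)) z e) y e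
      = L (fderiv ℝ (fun z => fderiv ℝ F z e) y e) := by
    intro y hy e
    have h1 : (fun z => fderiv ℝ (fun z => L (F z)) z e) =ᶠ[𝓝 y] fun z => L (fderiv ℝ F z e) := by
      filter_upwards [hΩ.mem_nhds hy] with z hz using e1 z hz e
    rw [h1.fderiv_eq]
    have := L.hasFDerivAt.comp y (aux_diff2 hΩ hF hy e).hasFDerivAt
    have h2 : fderiv ℝ (fun z => L (fderiv ℝ F z e)) y
      = L.comp (fderiv ℝ (fun z => fderiv ℝ F z e) y) := this.fderiv
    rw [h2]; rfl
  have hx : x ∈ Ω := hB (Metric.mem_closedBall_self hd.le)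
  have hLF : ContDiffOn ℝ 2 (fun z => L (F z)) Ω := L.contDiff.comp_contDiffOn hF
  have := aux_grad_le hΩ hLF x d M N hd hB (fun y hy => (hL _).trans (hM y hy)) (by
    intro y hy
    have : ∑ i : Fin 3, fderiv ℝ (fun z => fderiv ℝ (fun z => L (F z)) z (Pi.single i 1)) y
        (Pi.single i 1) = L (lap3 F y) := by
      unfold lap3
      rw [map_sum]
      exact Finset.sum_congr rfl fun j _ => e2 y (hB hy) _
    rw [this]
    exact (hL _).trans_lt (hN y hy)) i
  rw [e1 x hx] at this
  exact this

/-- Interior gradient estimate for Poisson's equation. -/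
theorem aux_grad_C {Ω : Set (Fin 3 → ℝ)} (hΩ : IsOpen Ω) {F : (Fin 3 → ℝ) → ℂ}
    (hF : ContDiffOn ℝ 2 F Ω) (x : Fin 3 → ℝ) (d M N : ℝ) (hd : 0 < d)
    (hB : Metric.closedBall x d ⊆ Ω) (hM : ∀ y ∈ Metric.closedBall x d, ‖F y‖ ≤ M)
    (hN : ∀ y ∈ Metric.closedBall x d, ‖lap3 F y‖ < N) (i : Fin 3) :
    ‖pd i F x‖ ≤ 2 * (3 * M / d + d * N / 2) := by
  have key := aux_clm hΩ hF x d M N hd hB hM hN i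
  have r1 := key Complex.reCLM (fun z => Complex.abs_re_le_norm z)
  have r2 := key (-Complex.reCLM) (fun z => by simpa using Complex.abs_re_le_norm z)
  have i1 := key Complex.imCLM (fun z => Complex.abs_im_le_norm z)
  have i2 := key (-Complex.imCLM) (fun z => by simpa using Complex.abs_im_le_norm z)
  simp only [neg_apply, Complex.reCLM_apply, Complex.imCLM_apply] at r1 r2 i1 i2
  have hr : |(pd i F x).re| ≤ 3 * M / d + d * N / 2 := abs_le.2 ⟨by linarith, r1⟩
  have hi : |(pd i F x).im| ≤ 3 * M / d + d * N / 2 := abs_le.2 ⟨by linarith, i1⟩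
  have := Complex.norm_le_abs_re_add_abs_im (pd i F x)
  linarith

theorem aux_pd_lin {Ω : Set (Fin 3 → ℝ)} (hΩ : IsOpen Ω) {F G H : (Fin 3 → ℝ) → ℂ}
    (hF : ContDiffOn ℝ 2 F Ω) (hG : ContDiffOn ℝ 2 G Ω) (hH : ContDiffOn ℝ 2 H Ω)
    (a b e : ℂ) (i : Fin 3) {y : Fin 3 → ℝ} (hy : y ∈ Ω) :
    pd i (fun z => a * F z + b * G z + e * H z) y = a * pd i F y + b * pd i G y + e * pd i H y := by
  have := (((aux_diff1 hΩ hF hy).hasFDerivAt.const_mul a).add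
    ((aux_diff1 hΩ hG hy).hasFDerivAt.const_mul b)).add
    ((aux_diff1 hΩ hH hy).hasFDerivAt.const_mul e)
  unfold pd
  have h2 : fderiv ℝ (fun z => a * F z + b * G z + e * H z) y = _ := this.fderiv
  rw [h2]
  simp

theorem aux_lap_lin {Ω : Set (Fin 3 → ℝ)} (hΩ : IsOpen Ω) {F G H : (Fin 3 → ℝ) → ℂ}
    (hF : ContDiffOn ℝ 2 F Ω) (hG : ContDiffOn ℝ 2 G Ω) (hH : ContDiffOn ℝ 2 H Ω)
    (a b e : ℂ) {y : Fin 3 → ℝ} (hy : y ∈ Ω) :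
    lap3 (fun z => a * F z + b * G z + e * H z) y = a * lap3 F y + b * lap3 G y + e * lap3 H y := by
  unfold lap3
  rw [Finset.mul_sum, Finset.mul_sum, Finset.mul_sum, ← Finset.sum_add_distrib,
    ← Finset.sum_add_distrib]
  refine Finset.sum_congr rfl fun j _ => ?_
  have h1 : (fun z => fderiv ℝ (fun z => a * F z + b * G z + e * H z) z (Pi.single j 1))
      =ᶠ[𝓝 y] fun z => a * fderiv ℝ F z (Pi.single j 1) + b * fderiv ℝ G z (Pi.single j 1)
        + e * fderiv ℝ H z (Pi.single j 1) := by
    filter_upwards [hΩ.mem_nhds hy] with z hz using aux_pd_lin hΩ hF hG hH a b e j hz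
  rw [h1.fderiv_eq]
  have := (((aux_diff2 hΩ hF hy (Pi.single j 1)).hasFDerivAt.const_mul a).add
    ((aux_diff2 hΩ hG hy (Pi.single j 1)).hasFDerivAt.const_mul b)).add
    ((aux_diff2 hΩ hH hy (Pi.single j 1)).hasFDerivAt.const_mul e)
  have h2 : fderiv ℝ (fun z => a * fderiv ℝ F z (Pi.single j 1) + b * fderiv ℝ G z (Pi.single j 1)
        + e * fderiv ℝ H z (Pi.single j 1)) y = _ := this.fderiv
  rw [h2]
  simp

theorem aux_pd_exp {Ω : Set (Fin 3 → ℝ)} (hΩ : IsOpen Ω) {F : (Fin 3 → ℝ) → ℂ}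
    (hF : ContDiffOn ℝ 2 F Ω) (i : Fin 3) {y : Fin 3 → ℝ} (hy : y ∈ Ω) :
    pd i (fun z => Complex.exp (F z)) y = Complex.exp (F y) * pd i F y := by
  have := (aux_diff1 hΩ hF hy).hasFDerivAt.cexp
  unfold pd
  rw [this.fderiv]
  simp

theorem aux_lap_exp {Ω : Set (Fin 3 → ℝ)} (hΩ : IsOpen Ω) {F : (Fin 3 → ℝ) → ℂ}
    (hF : ContDiffOn ℝ 2 F Ω) {y : Fin 3 → ℝ} (hy : y ∈ Ω) :
    lap3 (fun z => Complex.exp (F z)) y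
      = Complex.exp (F y) * (lap3 F y + ∑ i : Fin 3, (pd i F y) ^ 2) := by
  unfold lap3
  rw [← Finset.sum_add_distrib, Finset.mul_sum]
  refine Finset.sum_congr rfl fun j _ => ?_
  have h1 : (fun z => fderiv ℝ (fun z => Complex.exp (F z)) z (Pi.single j 1))
      =ᶠ[𝓝 y] fun z => Complex.exp (F z) * fderiv ℝ F z (Pi.single j 1) := by
    filter_upwards [hΩ.mem_nhds hy] with z hz using aux_pd_exp hΩ hF j hz
  rw [h1.fderiv_eq]
  have := (aux_diff1 hΩ hF hy).hasFDerivAt.cexp.mul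
    (aux_diff2 hΩ hF hy (Pi.single j 1)).hasFDerivAt
  have h2 : fderiv ℝ (fun z => Complex.exp (F z) * fderiv ℝ F z (Pi.single j 1)) y = _ := this.fderiv
  rw [h2]
  simp [pd]
  ring

theorem aux_taylor {B : Set (Fin 3 → ℝ)} (hB : IsCompact B) (kl ku : ℝ)
    (T T' : (Fin 3 → ℝ) → ℝ → ℂ)
    (hT : ∀ y ∈ B, ∀ k ∈ Icc kl ku, HasDerivAt (T y) (T' y k) k)
    (hc : ContinuousOn (fun p : (Fin 3 → ℝ) × ℝ => T' p.1 p.2) (B ×ˢ Icc kl ku))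
    (k0 : ℝ) (hk0 : k0 ∈ Icc kl ku) (ε : ℝ) (hε : 0 < ε) :
    ∃ δ > 0, ∀ k ∈ Icc kl ku, |k - k0| < δ → ∀ y ∈ B,
      ‖T y k - T y k0 - (k - k0 : ℝ) * T' y k0‖ ≤ ε * |k - k0| := by
  have hu := (hB.prod isCompact_Icc).uniformContinuousOn_of_continuous hc
  obtain ⟨δ, hδ, h⟩ := Metric.uniformContinuousOn_iff.1 hu ε hε
  refine ⟨δ, hδ, fun k hk hkd y hy => ?_⟩
  have hsub : uIcc k0 k ⊆ Icc kl ku := ordConnected_Icc.uIcc_subset hk0 hk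
  have := (convex_uIcc k0 k).norm_image_sub_le_of_norm_hasDerivWithin_le
    (f := fun s : ℝ => T y s - (s : ℂ) * T' y k0) (f' := fun s => T' y s - T' y k0) (C := ε)
    (fun s hs => by
      have h1 : HasDerivAt (fun s : ℝ => (s : ℂ)) 1 s := Complex.ofRealCLM.hasDerivAt
      have := (hT y hy s (hsub hs)).sub (h1.mul_const (T' y k0))
      rw [one_mul] at this
      exact this.hasDerivWithinAt)
    (fun s hs => by
      have := h (y, s) ⟨hy, hsub hs⟩ (y, k0) ⟨hy, hk0⟩ (by
        rw [Prod.dist_eq, dist_self, Real.dist_eq]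
        refine max_lt hδ (lt_of_le_of_lt ?_ hkd)
        exact abs_sub_left_of_mem_uIcc hs)
      rw [dist_eq_norm] at this
      exact this.le)
    left_mem_uIcc right_mem_uIcc
  rw [Real.norm_eq_abs] at this
  have e : T y k - T y k0 - (k - k0 : ℝ) * T' y k0
      = T y k - (k : ℂ) * T' y k0 - (T y k0 - (k0 : ℂ) * T' y k0) := by
    push_cast
    ring
  rw [e]
  exact this

theorem aux_reg {Ω : Set (Fin 3 → ℝ)} (hΩ : IsOpen Ω) (x : Fin 3 → ℝ) (d C : ℝ) (hd : 0 < d)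
    (hB : Metric.closedBall x d ⊆ Ω) (kl ku : ℝ) (hk : kl < ku) (c : (Fin 3 → ℝ) → ℂ)
    (hC : ∀ y ∈ Metric.closedBall x d, ‖c y‖ ≤ C)
    (U W : (Fin 3 → ℝ) → ℝ → ℂ)
    (hU : ∀ k ∈ Icc kl ku, ContDiffOn ℝ 2 (fun y => U y k) Ω)
    (hUW : ∀ y ∈ Metric.closedBall x d, ∀ k ∈ Icc kl ku, HasDerivAt (U y) (W y k) k)
    (hUc : ContinuousOn (fun p : (Fin 3 → ℝ) × ℝ => U p.1 p.2) (Metric.closedBall x d ×ˢ Icc kl ku))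
    (hWc : ContinuousOn (fun p : (Fin 3 → ℝ) × ℝ => W p.1 p.2) (Metric.closedBall x d ×ˢ Icc kl ku))
    (hlap : ∀ y ∈ Metric.closedBall x d, ∀ k ∈ Icc kl ku,
      lap3 (fun y => U y k) y = -(k : ℂ) ^ 2 * c y * U y k)
    (i : Fin 3) (k0 : ℝ) (hk0 : k0 ∈ Icc kl ku) :
    DifferentiableWithinAt ℝ (fun k => pd i (fun y => U y k) x) (Icc kl ku) k0 := by
  have hx : x ∈ Ω := hB (Metric.mem_closedBall_self hd.le)
  have hC0 : 0 ≤ C := (norm_nonneg _).trans (hC x (Metric.mem_closedBall_self hd.le))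
  have hcomp := isCompact_closedBall x d
  set P : ℝ → ℂ := fun k => pd i (fun y => U y k) x with hP
  have hne : (𝓝[Icc kl ku \ {k0}] k0).NeBot := by
    have := (uniqueDiffOn_Icc hk) k0 hk0
    have := this.accPt
    rw [accPt_principal_iff_nhdsWithin] at this
    exact this
  have tay1 := aux_taylor hcomp kl ku U W hUW hWc k0 hk0
  have tay2 := aux_taylor hcomp kl ku (fun y k => (k:ℂ) ^ 2 * U y k)
    (fun y k => 2 * (k:ℂ) * U y k + (k:ℂ) ^ 2 * W y k) (by
      intro y hy k hk
      have h1 : HasDerivAt (fun s : ℝ => (s : ℂ)) 1 k := Complex.ofRealCLM.hasDerivAt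
      have := (h1.pow 2).mul (hUW y hy k hk)
      exact this.congr_deriv (by simp))
    (by
      have : Continuous (fun p : (Fin 3 → ℝ) × ℝ => (p.2 : ℂ)) := by fun_prop
      exact (((continuous_const.mul this).continuousOn).mul hUc).add
        ((this.pow 2).continuousOn.mul hWc)) k0 hk0
  have hcauchy : Cauchy (map (slope P k0) (𝓝[Icc kl ku \ {k0}] k0)) := by
    rw [Metric.cauchy_iff]
    refine ⟨hne.map _, fun η hη => ?_⟩
    set Kc : ℝ := 2 * (3 * 2 / d + d * (2 * C + 1) / 2) with hKc
    have hKc0 : 0 < Kc := by positivity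
    obtain ⟨ε, hε, hεη⟩ : ∃ ε > 0, Kc * ε < η := ⟨η / (2 * Kc), by positivity, by
      field_simp; norm_num⟩
    obtain ⟨δ1, hδ1, t1⟩ := tay1 ε hε
    obtain ⟨δ2, hδ2, t2⟩ := tay2 ε hε
    refine ⟨slope P k0 '' ((Icc kl ku \ {k0}) ∩ Metric.ball k0 (min δ1 δ2)),
      image_mem_map (inter_mem self_mem_nhdsWithin
        (mem_nhdsWithin_of_mem_nhds (Metric.ball_mem_nhds _ (lt_min hδ1 hδ2)))), ?_⟩
    have q1 : ∀ (z z0 z' : ℂ) (k : ℝ), k ≠ k0 →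
        ‖z - z0 - (k - k0 : ℝ) * z'‖ ≤ ε * |k - k0| →
        ‖((k - k0 : ℝ) : ℂ)⁻¹ * (z - z0) - z'‖ ≤ ε := by
      intro z z0 z' k hkk h
      have hk' : k - k0 ≠ 0 := sub_ne_zero.2 hkk
      have hkc : ((k - k0 : ℝ) : ℂ) ≠ 0 := by exact_mod_cast hk'
      have e : ((k - k0 : ℝ) : ℂ)⁻¹ * (z - z0) - z'
        = ((k - k0 : ℝ) : ℂ)⁻¹ * (z - z0 - (k - k0 : ℝ) * z') := by
        field_simp
      rw [e, norm_mul, norm_inv, Complex.norm_real, Real.norm_eq_abs]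
      have : 0 < |k - k0| := abs_pos.2 hk'
      rw [inv_mul_le_iff₀ this, mul_comm |k - k0| ε]
      exact h
    rintro _ ⟨k1, ⟨⟨hk1, hk1n⟩, hk1d⟩, rfl⟩ _ ⟨k2, ⟨⟨hk2, hk2n⟩, hk2d⟩, rfl⟩
    rw [Metric.mem_ball, Real.dist_eq, lt_min_iff] at hk1d hk2d
    set a : ℂ := ((k1 - k0 : ℝ) : ℂ)⁻¹ with ha
    set b : ℂ := ((k2 - k0 : ℝ) : ℂ)⁻¹ with hb
    have hF : ContDiffOn ℝ 2 (fun z => a * U z k1 + (-b) * U z k2 + (b - a) * U z k0) Ω :=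
      (((contDiffOn_const).mul (hU k1 hk1)).add ((contDiffOn_const).mul (hU k2 hk2))).add
        ((contDiffOn_const).mul (hU k0 hk0))
    have est := aux_grad_C hΩ hF x d (2 * ε) ((2 * C + 1) * ε) hd hB (by
      intro y hy
      have u1 := q1 _ _ _ k1 hk1n (t1 k1 hk1 hk1d.1 y hy)
      have u2 := q1 _ _ _ k2 hk2n (t1 k2 hk2 hk2d.1 y hy)
      have e : a * U y k1 + (-b) * U y k2 + (b - a) * U y k0
        = (a * (U y k1 - U y k0) - W y k0) - (b * (U y k2 - U y k0) - W y k0) := by ring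
      simp only [e]
      exact (norm_sub_le _ _).trans (by linarith)) (by
      intro y hy
      have u1 := q1 _ _ _ k1 hk1n (t2 k1 hk1 hk1d.2 y hy)
      have u2 := q1 _ _ _ k2 hk2n (t2 k2 hk2 hk2d.2 y hy)
      rw [aux_lap_lin hΩ (hU k1 hk1) (hU k2 hk2) (hU k0 hk0) a (-b) (b - a) (hB hy),
        hlap y hy k1 hk1, hlap y hy k2 hk2, hlap y hy k0 hk0]
      set Z := 2 * (k0:ℂ) * U y k0 + (k0:ℂ) ^ 2 * W y k0 with hZ
      have e : a * (-(k1:ℂ) ^ 2 * c y * U y k1) + -b * (-(k2:ℂ) ^ 2 * c y * U y k2)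
          + (b - a) * (-(k0:ℂ) ^ 2 * c y * U y k0)
        = (-c y) * ((a * ((k1:ℂ) ^ 2 * U y k1 - (k0:ℂ) ^ 2 * U y k0) - Z)
          - (b * ((k2:ℂ) ^ 2 * U y k2 - (k0:ℂ) ^ 2 * U y k0) - Z)) := by ring
      rw [e, norm_mul, norm_neg]
      calc _ ≤ C * (2 * ε) := by
            refine mul_le_mul (hC y hy) ((norm_sub_le _ _).trans (by linarith)) (norm_nonneg _) hC0
        _ < (2 * C + 1) * ε := by nlinarith) i
    rw [aux_pd_lin hΩ (hU k1 hk1) (hU k2 hk2) (hU k0 hk0) a (-b) (b - a) i hx] at est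
    have e3 : slope P k0 k1 - slope P k0 k2 = a * P k1 + -b * P k2 + (b - a) * P k0 := by
      simp only [slope, vsub_eq_sub, ha, hb, Complex.real_smul, Complex.ofReal_inv]
      ring
    rw [dist_eq_norm, e3]
    refine lt_of_le_of_lt est ?_
    calc 2 * (3 * (2 * ε) / d + d * ((2 * C + 1) * ε) / 2) = Kc * ε := by rw [hKc]; ring
      _ < η := hεη
  obtain ⟨l, hl⟩ := CompleteSpace.complete hcauchy
  have : HasDerivWithinAt P l (Icc kl ku) k0 := hasDerivWithinAt_iff_tendsto_slope.2 hl
  exact this.differentiableWithinAt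

theorem aux_cont_lap {Ω : Set (Fin 3 → ℝ)} (hΩ : IsOpen Ω) {F : (Fin 3 → ℝ) → ℂ}
    (hF : ContDiffOn ℝ 2 F Ω) :
    ContinuousOn (fun y => lap3 F y + ∑ i : Fin 3, (pd i F y) ^ 2) Ω := by
  intro y hy
  apply ContinuousAt.continuousWithinAt
  have h0 := (hF.contDiffAt (hΩ.mem_nhds hy)).fderiv_right (m := 1) (by norm_num)
  have h1 : ∀ e : Fin 3 → ℝ, ContDiffAt ℝ 1 (fun z => fderiv ℝ F z e) y :=
    fun e => h0.clm_apply contDiffAt_const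
  have h2 : ∀ e : Fin 3 → ℝ, ContinuousAt (fun z => fderiv ℝ (fun z => fderiv ℝ F z e) z e) y :=
    fun e => (((h1 e).fderiv_right (m := 0) (by norm_num)).clm_apply
      contDiffAt_const).continuousAt
  have h3 : ContinuousAt (fun y => ∑ i : Fin 3, (pd i F y) ^ 2) y :=
    tendsto_finsetSum _ fun i _ => ((h1 (Pi.single i 1)).continuousAt.pow 2)
  have h4 : ContinuousAt (lap3 F) y := tendsto_finsetSum _ fun i _ => h2 (Pi.single i 1)
  exact h4.add h3

theorem aux_cont_joint {B : Set (Fin 3 → ℝ)} (hB : IsCompact B) (kl ku : ℝ)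
    (v q : (Fin 3 → ℝ) → ℝ → ℂ) (hv : ∀ k ∈ Icc kl ku, ContinuousOn (fun y => v y k) B)
    (hvq : ∀ y ∈ B, ∀ k ∈ Icc kl ku, HasDerivAt (v y) (q y k) k)
    (hq : ContinuousOn (fun p : (Fin 3 → ℝ) × ℝ => q p.1 p.2) (B ×ˢ Icc kl ku)) :
    ContinuousOn (fun p : (Fin 3 → ℝ) × ℝ => v p.1 p.2) (B ×ˢ Icc kl ku) := by
  obtain ⟨Q, hQ⟩ := (hB.prod isCompact_Icc).exists_bound_of_continuousOn hq
  have hlip : ∀ y ∈ B, ∀ k ∈ Icc kl ku, ∀ k' ∈ Icc kl ku, ‖v y k' - v y k‖ ≤ Q * ‖k' - k‖ := by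
    intro y hy k hk k' hk'
    exact (convex_Icc kl ku).norm_image_sub_le_of_norm_hasDerivWithin_le
      (fun s hs => (hvq y hy s hs).hasDerivWithinAt) (fun s hs => hQ (y, s) ⟨hy, hs⟩) hk hk'
  rintro ⟨y0, k0⟩ ⟨hy0, hk0⟩
  have hy0' : y0 ∈ B := hy0
  have hk0' : k0 ∈ Icc kl ku := hk0
  have t1 : Tendsto (fun p : (Fin 3 → ℝ) × ℝ => v p.1 k0) (𝓝[B ×ˢ Icc kl ku] (y0, k0))
      (𝓝 (v y0 k0)) := by
    have := (hv k0 hk0' y0 hy0').comp (s := B ×ˢ Icc kl ku) (x := (y0, k0)) (f := Prod.fst)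
      continuous_fst.continuousWithinAt (fun p hp => hp.1)
    exact this
  have t2 : Tendsto (fun p : (Fin 3 → ℝ) × ℝ => v p.1 p.2 - v p.1 k0)
      (𝓝[B ×ˢ Icc kl ku] (y0, k0)) (𝓝 0) := by
    have hc : Continuous (fun p : (Fin 3 → ℝ) × ℝ => Q * ‖p.2 - k0‖) := by fun_prop
    have h0 : Tendsto (fun p : (Fin 3 → ℝ) × ℝ => Q * ‖p.2 - k0‖)
      (𝓝[B ×ˢ Icc kl ku] (y0, k0)) (𝓝 0) := by
      have := (hc.tendsto (y0, k0)).mono_left (nhdsWithin_le_nhds (s := B ×ˢ Icc kl ku))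
      simpa using this
    refine squeeze_zero_norm' ?_ h0
    filter_upwards [self_mem_nhdsWithin] with p hp
    exact hlip p.1 hp.1 k0 hk0' p.2 hp.2
  have := t2.add t1
  simpa [ContinuousWithinAt] using this

set_option maxHeartbeats 2000000 in
/-- Eliminating `v` via `v(x,k) = −∫_k^{k̄} q(x,s) ds + V(x)`, with
`q = ∂_k v` and tail function `V = v(·, k̄)`, the Riccati-type equation yields the
integro-differential equation
`(k/2) Δ_x q + k ∇_x q · (−∫_k^{k̄} ∇_x q ds + ∇V)
  = −∫_k^{k̄} Δ_x q ds + ΔV + (−∫_k^{k̄} ∇_x q ds + ∇V)²` on `Ω × [k̲, k̄]`. -/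
theorem integro_differential_equation
    (Ω : Set (Fin 3 → ℝ)) (hΩ : IsOpen Ω) (c : (Fin 3 → ℝ) → ℂ)
    (kl ku : ℝ) (hkl : 0 < kl) (hk : kl < ku)
    (v : (Fin 3 → ℝ) → ℝ → ℂ)
    (hvx : ∀ k ∈ Set.Icc kl ku, ContDiffOn ℝ 2 (fun x => v x k) Ω)
    (hvk : ∀ x ∈ Ω, ∀ k ∈ Set.Icc kl ku, DifferentiableAt ℝ (v x) k)
    (hmix1 : ∀ x ∈ Ω, ∀ k ∈ Set.Icc kl ku, ∀ i : Fin 3,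
      deriv (fun k' => pd i (fun y => v y k') x) k
        = pd i (fun y => deriv (v y) k) x)
    (hmix2 : ∀ x ∈ Ω, ∀ k ∈ Set.Icc kl ku,
      deriv (fun k' => lap3 (fun y => v y k') x) k
        = lap3 (fun y => deriv (v y) k) x)
    -- continuity in `(x, k)` of `q = ∂_k v`, of its spatial gradient and of its
    -- spatial Laplacian
    (hqc : ContinuousOn (fun p : (Fin 3 → ℝ) × ℝ => deriv (v p.1) p.2)
      (Ω ×ˢ Set.Icc kl ku))
    (hgqc : ∀ i : Fin 3,
      ContinuousOn (fun p : (Fin 3 → ℝ) × ℝ => pd i (fun y => deriv (v y) p.2) p.1)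
        (Ω ×ˢ Set.Icc kl ku))
    (hlqc : ContinuousOn (fun p : (Fin 3 → ℝ) × ℝ => lap3 (fun y => deriv (v y) p.2) p.1)
      (Ω ×ˢ Set.Icc kl ku))
    (hriccati : ∀ x ∈ Ω, ∀ k ∈ Set.Icc kl ku,
      lap3 (fun y => v y k) x + ∑ i : Fin 3, (pd i (fun y => v y k) x) ^ 2
        = -(k : ℂ) ^ 2 * c x) :
    ∀ x ∈ Ω, ∀ k ∈ Set.Icc kl ku,
      ((k : ℂ) / 2) * lap3 (fun y => deriv (v y) k) x
        + (k : ℂ) * ∑ i : Fin 3,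
            pd i (fun y => deriv (v y) k) x *
              (-(∫ s in k..ku, pd i (fun y => deriv (v y) s) x)
                + pd i (fun y => v y ku) x)
      = -(∫ s in k..ku, lap3 (fun y => deriv (v y) s) x)
          + lap3 (fun y => v y ku) x
          + ∑ i : Fin 3,
              (-(∫ s in k..ku, pd i (fun y => deriv (v y) s) x)
                + pd i (fun y => v y ku) x) ^ 2 := by
  intro x hx
  obtain ⟨d, hd, hB⟩ := Metric.nhds_basis_closedBall.mem_iff.1 (hΩ.mem_nhds hx)
  have hcomp := isCompact_closedBall x d
  have hBI : Metric.closedBall x d ×ˢ Icc kl ku ⊆ Ω ×ˢ Icc kl ku := prod_mono hB Subset.rfl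
  have hku : ku ∈ Icc kl ku := ⟨hk.le, le_rfl⟩
  have hku0 : (ku : ℂ) ≠ 0 := by exact_mod_cast (hkl.trans hk).ne'
  have hvq : ∀ y ∈ Ω, ∀ k ∈ Icc kl ku, HasDerivAt (v y) (deriv (v y) k) k :=
    fun y hy k hk => (hvk y hy k hk).hasDerivAt
  have hvc := aux_cont_joint hcomp kl ku v (fun y k => deriv (v y) k)
    (fun k hk => (hvx k hk).continuousOn.mono hB) (fun y hy => hvq y (hB hy)) (hqc.mono hBI)
  obtain ⟨C, hC⟩ := hcomp.exists_bound_of_continuousOn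
    (((aux_cont_lap hΩ (hvx ku hku)).mono hB).div_const (-(ku : ℂ) ^ 2))
  have hC' : ∀ y ∈ Metric.closedBall x d, ‖c y‖ ≤ C := by
    intro y hy
    have h := hC y hy
    rw [hriccati y (hB hy) ku hku, mul_div_cancel_left₀] at h
    · exact h
    · exact neg_ne_zero.2 (pow_ne_zero _ hku0)
  -- regularity in `k` of the gradient of `exp v`
  have w1 : ∀ k ∈ Icc kl ku, ContDiffOn ℝ 2 (fun y => Complex.exp (v y k)) Ω :=
    fun k hk => (hvx k hk).cexp
  have w2 : ∀ y ∈ Metric.closedBall x d, ∀ k ∈ Icc kl ku,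
      HasDerivAt (fun k => Complex.exp (v y k)) (Complex.exp (v y k) * deriv (v y) k) k :=
    fun y hy k hk => (hvq y (hB hy) k hk).cexp
  have w3 : ContinuousOn (fun p : (Fin 3 → ℝ) × ℝ => Complex.exp (v p.1 p.2))
      (Metric.closedBall x d ×ˢ Icc kl ku) := hvc.cexp
  have w4 : ContinuousOn (fun p : (Fin 3 → ℝ) × ℝ => Complex.exp (v p.1 p.2) * deriv (v p.1) p.2)
      (Metric.closedBall x d ×ˢ Icc kl ku) := w3.mul (hqc.mono hBI)
  have hreg := aux_reg hΩ x d C hd hB kl ku hk c hC' (fun y k => Complex.exp (v y k))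
    (fun y k => Complex.exp (v y k) * deriv (v y) k)
    w1 w2 w3 w4
    (fun y hy k hk => by
      rw [aux_lap_exp hΩ (hvx k hk) (hB hy), hriccati y (hB hy) k hk]; ring)
  set P : Fin 3 → ℝ → ℂ := fun i k => pd i (fun y => v y k) x with hP
  set Λ : ℝ → ℂ := fun k => lap3 (fun y => v y k) x with hΛ
  set G : Fin 3 → ℝ → ℂ := fun i k => pd i (fun y => deriv (v y) k) x with hG
  set L : ℝ → ℂ := fun k => lap3 (fun y => deriv (v y) k) x with hL
  have hof : ∀ k : ℝ, HasDerivAt (fun s : ℝ => (s : ℂ)) 1 k :=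
    fun k => Complex.ofRealCLM.hasDerivAt
  have hPd : ∀ i, DifferentiableOn ℝ (P i) (Icc kl ku) := by
    intro i k0 hk0
    have h1 := hreg i k0 hk0
    have h2 : DifferentiableWithinAt ℝ (fun k => Complex.exp (- v x k)) (Icc kl ku) k0 :=
      (hvk x hx k0 hk0).neg.cexp.differentiableWithinAt
    have e : ∀ k ∈ Icc kl ku, P i k
        = Complex.exp (- v x k) * pd i (fun y => Complex.exp (v y k)) x := by
      intro k hk
      rw [aux_pd_exp hΩ (hvx k hk) i hx, ← mul_assoc, ← Complex.exp_add]
      simp [hP]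
    exact (h2.mul h1).congr e (e k0 hk0)
  have hΛe : ∀ k ∈ Icc kl ku, Λ k = -(k : ℂ) ^ 2 * c x - ∑ i, (P i k) ^ 2 := by
    intro k hk
    rw [← hriccati x hx k hk]; simp [hΛ, hP]
  have hΛd : DifferentiableOn ℝ Λ (Icc kl ku) := by
    intro k0 hk0
    have h1 : DifferentiableWithinAt ℝ (fun k : ℝ => -(k : ℂ) ^ 2 * c x) (Icc kl ku) k0 :=
      (((hof k0).pow 2).neg.mul_const (c x)).differentiableAt.differentiableWithinAt
    have h2 : DifferentiableWithinAt ℝ (fun k : ℝ => ∑ i, (P i k) ^ 2) (Icc kl ku) k0 :=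
      DifferentiableWithinAt.fun_sum fun i _ => (hPd i k0 hk0).pow 2
    exact (h1.sub h2).congr hΛe (hΛe k0 hk0)
  have hPG : ∀ i, ∀ k ∈ Ioo kl ku, HasDerivAt (P i) (G i k) k := by
    intro i k hk
    have h := ((hPd i k (Ioo_subset_Icc_self hk)).differentiableAt
      (Icc_mem_nhds hk.1 hk.2)).hasDerivAt
    rw [hmix1 x hx k (Ioo_subset_Icc_self hk) i] at h
    exact h
  have hΛL : ∀ k ∈ Ioo kl ku, HasDerivAt Λ (L k) k := by
    intro k hk
    have h := ((hΛd k (Ioo_subset_Icc_self hk)).differentiableAt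
      (Icc_mem_nhds hk.1 hk.2)).hasDerivAt
    rw [hmix2 x hx k (Ioo_subset_Icc_self hk)] at h
    exact h
  have hmk : ContinuousOn (fun k : ℝ => (x, k)) (Icc kl ku) := by fun_prop
  have hmaps : MapsTo (fun k : ℝ => (x, k)) (Icc kl ku) (Ω ×ˢ Icc kl ku) :=
    fun k hk => mk_mem_prod hx hk
  have hGc : ∀ i, ContinuousOn (G i) (Icc kl ku) := by
    intro i
    have h := (hgqc i).comp hmk hmaps
    simp only [Function.comp_def] at h
    exact h
  have hLc : ContinuousOn L (Icc kl ku) := by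
    have h := hlqc.comp hmk hmaps
    simp only [Function.comp_def] at h
    exact h
  have ident : EqOn (fun k => L k + ∑ i, 2 * P i k * G i k) (fun k : ℝ => -2 * (k : ℂ) * c x)
      (Icc kl ku) := by
    have h0 : EqOn (fun k => L k + ∑ i, 2 * P i k * G i k) (fun k : ℝ => -2 * (k : ℂ) * c x)
      (Ioo kl ku) := by
      intro k hk
      have h1 : HasDerivAt (fun k => Λ k + ∑ i, (P i k) ^ 2) (L k + ∑ i, 2 * P i k * G i k) k := by
        have hs : HasDerivAt (fun k => ∑ i, (P i k) ^ 2) (∑ i, 2 * P i k * G i k) k := by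
          apply HasDerivAt.fun_sum
          intro i _
          exact ((hPG i k hk).pow 2).congr_deriv (by simp)
        exact (hΛL k hk).add hs
      have h2 : HasDerivAt (fun k : ℝ => -(k : ℂ) ^ 2 * c x) (-2 * (k : ℂ) * c x) k :=
        ((((hof k).pow 2).neg.mul_const (c x))).congr_deriv (by simp)
      have h3 : (fun k => Λ k + ∑ i, (P i k) ^ 2) =ᶠ[𝓝 k] (fun k : ℝ => -(k : ℂ) ^ 2 * c x) := by
        filter_upwards [Icc_mem_nhds hk.1 hk.2] with s hs using hriccati x hx s hs
      exact h1.unique (h2.congr_of_eventuallyEq h3)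
    have hi : ∀ i, ContinuousOn (fun k => 2 * P i k * G i k) (Icc kl ku) := fun i =>
      (continuousOn_const.mul (hPd i).continuousOn).mul (hGc i)
    have hs : ContinuousOn (fun k => ∑ i, 2 * P i k * G i k) (Icc kl ku) :=
      continuousOn_finsetSum _ fun i _ => hi i
    have hl : ContinuousOn (fun k => L k + ∑ i, 2 * P i k * G i k) (Icc kl ku) := hLc.add hs
    have hr : ContinuousOn (fun k : ℝ => -2 * (k : ℂ) * c x) (Icc kl ku) := by fun_prop
    exact h0.of_subset_closure hl hr Ioo_subset_Icc_self (by rw [closure_Ioo hk.ne])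
  intro k hkm
  have hsub : Icc k ku ⊆ Icc kl ku := Icc_subset_Icc_left hkm.1
  have hsub' : Ioo k ku ⊆ Ioo kl ku := Ioo_subset_Ioo_left hkm.1
  have f1 : ∀ i, ∫ s in k..ku, G i s = P i ku - P i k := fun i =>
    intervalIntegral.integral_eq_sub_of_hasDerivAt_of_le hkm.2 ((hPd i).continuousOn.mono hsub)
      (fun s hs => hPG i s (hsub' hs)) (((hGc i).mono hsub).intervalIntegrable_of_Icc hkm.2)
  have f2 : ∫ s in k..ku, L s = Λ ku - Λ k :=
    intervalIntegral.integral_eq_sub_of_hasDerivAt_of_le hkm.2 (hΛd.continuousOn.mono hsub)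
      (fun s hs => hΛL s (hsub' hs)) ((hLc.mono hsub).intervalIntegrable_of_Icc hkm.2)
  have g1 := ident hkm
  have g2 := hΛe k hkm
  change ((k : ℂ) / 2) * L k + (k : ℂ) * ∑ i, G i k * (-(∫ s in k..ku, G i s) + P i ku)
    = -(∫ s in k..ku, L s) + Λ ku + ∑ i, (-(∫ s in k..ku, G i s) + P i ku) ^ 2
  simp only [f1, f2]
  simp only [Fin.sum_univ_three] at g1 g2 ⊢
  linear_combination (k : ℂ) / 2 * g1 - g2

end
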